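/- For a finite MDP, let L : S → ℝ satisfy L(s) > 0 for all s, and let V, V̄ : S → ℝ. Then for every state s ∈ S, |(TV)(s) − (TV̄)(s)| ≤ γ · ‖V − V̄‖_{∞,1/L} · (HL)(s). -/

import Mathlib

open Finset

section Defs

variable {S A : Type*} [Fintype S] [Nonempty S] [Fintype A] [Nonempty A]

/-- The Bellman operator: `(T V)(s) = max_a [R(s) + γ ∑_{s'} P(s'|s,a) V(s')]`. -/
noncomputable def bellman (P : S → A → S → ℝ) (R : S → ℝ) (γ : ℝ) (V : S → ℝ) (s : S) : ℝ :=
  univ.sup' univ_nonempty fun a => R s + γ * ∑ s', P s a s' * V s'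

/-- The operator `H`: `(H L)(s) = max_a ∑_{s'} P(s'|s,a) L(s')`. -/
noncomputable def Hop (P : S → A → S → ℝ) (L : S → ℝ) (s : S) : ℝ :=
  univ.sup' univ_nonempty fun a => ∑ s', P s a s' * L s'

/-- `(Φ w)(s) = ∑ i, Φ_i(s) w_i`. -/
def phiW {k : ℕ} (Φ : S → Fin (k + 1) → ℝ) (w : Fin (k + 1) → ℝ) (s : S) : ℝ :=
  ∑ i, Φ s i * w i

/-- `‖w‖_{-1}`: the ℓ¹ norm of `w` with the bias coordinate (index 0) excluded. -/
def normNeg1 {k : ℕ} (w : Fin (k + 1) → ℝ) : ℝ :=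
  ∑ i ∈ Finset.univ.erase 0, |w i|

/-- The weighted max-norm `‖U‖_{∞,1/L} = max_s |U(s)| / L(s)`. -/
noncomputable def wmaxNorm (L U : S → ℝ) : ℝ :=
  univ.sup' univ_nonempty fun s => |U s| / L s

/-- The weighted L¹ norm `‖U‖_{1,ρ} = ∑_s ρ(s) |U(s)|`. -/
def w1Norm (ρ U : S → ℝ) : ℝ := ∑ s, ρ s * |U s|

/-- The max-absolute-value norm on functions `S → ℝ`. -/
noncomputable def maxNorm (U : S → ℝ) : ℝ :=
  univ.sup' univ_nonempty fun s => |U s|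

/-- RALP feasibility: `‖w‖_{-1} ≤ ψ` and all Bellman (state-action) constraints hold. -/
def RALPfeasible {k : ℕ} (P : S → A → S → ℝ) (R : S → ℝ) (γ : ℝ)
    (Φ : S → Fin (k + 1) → ℝ) (ψ : ℝ) (w : Fin (k + 1) → ℝ) : Prop :=
  normNeg1 w ≤ ψ ∧
    ∀ s a, R s + γ * ∑ s', P s a s' * phiW Φ w s' ≤ phiW Φ w s

/-- A RALP solution: a feasible `w` minimizing `∑ s, ρ s * (Φ w)(s)` over feasible vectors. -/
def RALPsolution {k : ℕ} (P : S → A → S → ℝ) (R : S → ℝ) (γ : ℝ)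
    (Φ : S → Fin (k + 1) → ℝ) (ψ : ℝ) (ρ : S → ℝ) (w : Fin (k + 1) → ℝ) : Prop :=
  RALPfeasible P R γ Φ ψ w ∧
    ∀ w', RALPfeasible P R γ Φ ψ w' →
      ∑ s, ρ s * phiW Φ w s ≤ ∑ s, ρ s * phiW Φ w' s

end Defs

theorem abs_le_wmaxNorm_mul {S : Type*} [Fintype S] [Nonempty S] {L : S → ℝ}
    (hL : ∀ s, 0 < L s) (U : S → ℝ) (s : S) : |U s| ≤ wmaxNorm L U * L s :=
  (div_le_iff₀ (hL s)).mp (le_sup' (fun s => |U s| / L s) (mem_univ s))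

theorem wmaxNorm_nonneg {S : Type*} [Fintype S] [Nonempty S] {L : S → ℝ}
    (hL : ∀ s, 0 < L s) (U : S → ℝ) : 0 ≤ wmaxNorm L U := by
  obtain ⟨s⟩ := ‹Nonempty S›
  exact (div_nonneg (abs_nonneg (U s)) (hL s).le).trans
    (le_sup' (fun s => |U s| / L s) (mem_univ s))

theorem wmaxNorm_sub_comm {S : Type*} [Fintype S] [Nonempty S] (L V W : S → ℝ) :
    wmaxNorm L (fun x => V x - W x) = wmaxNorm L (fun x => W x - V x) := by
  simp only [wmaxNorm, abs_sub_comm]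

theorem bellman_le_bellman_add {S A : Type*} [Fintype S] [Nonempty S] [Fintype A] [Nonempty A]
    {P : S → A → S → ℝ} (R : S → ℝ) {γ : ℝ} (hγ : 0 ≤ γ) (hP : ∀ s a s', 0 ≤ P s a s')
    {L : S → ℝ} (hL : ∀ s, 0 < L s) (V W : S → ℝ) (s : S) :
    bellman P R γ V s ≤
      bellman P R γ W s + γ * wmaxNorm L (fun x => V x - W x) * Hop P L s := by
  refine sup'_le _ _ fun a _ => ?_
  set c := wmaxNorm L (fun x => V x - W x)
  have hW : R s + γ * ∑ s', P s a s' * W s' ≤ bellman P R γ W s :=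
    le_sup' (fun a => R s + γ * ∑ s', P s a s' * W s') (mem_univ a)
  have hH : ∑ s', P s a s' * L s' ≤ Hop P L s :=
    le_sup' (fun a => ∑ s', P s a s' * L s') (mem_univ a)
  have hV : ∑ s', P s a s' * V s' ≤ ∑ s', P s a s' * W s' + c * ∑ s', P s a s' * L s' := by
    rw [mul_sum, ← sum_add_distrib]
    refine sum_le_sum fun s' _ => ?_
    have h : V s' - W s' ≤ c * L s' :=
      (le_abs_self _).trans (abs_le_wmaxNorm_mul hL (fun x => V x - W x) s')
    linarith [mul_le_mul_of_nonneg_left h (hP s a s')]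
  have hγc : 0 ≤ γ * c := mul_nonneg hγ (wmaxNorm_nonneg hL _)
  linarith [mul_le_mul_of_nonneg_left hV hγ, mul_le_mul_of_nonneg_left hH hγc]

/-- `|TV(s) − TV̄(s)| ≤ γ ‖V − V̄‖_{∞,1/L} (HL)(s)` for positive `L`. -/
theorem statement_5 {S A : Type*} [Fintype S] [Nonempty S] [Fintype A] [Nonempty A]
    (P : S → A → S → ℝ) (R : S → ℝ) (γ : ℝ) (hγ0 : 0 ≤ γ) (hγ1 : γ < 1)
    (hP0 : ∀ s a s', 0 ≤ P s a s') (hP1 : ∀ s a, ∑ s', P s a s' = 1)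
    (L : S → ℝ) (hL : ∀ s, 0 < L s)
    (V Vbar : S → ℝ) (s : S) :
    |bellman P R γ V s - bellman P R γ Vbar s| ≤
      γ * wmaxNorm L (fun x => V x - Vbar x) * Hop P L s := by
  rw [abs_sub_le_iff]
  constructor
  · linarith [bellman_le_bellman_add R hγ0 hP0 hL V Vbar s]
  · rw [wmaxNorm_sub_comm]
    linarith [bellman_le_bellman_add R hγ0 hP0 hL Vbar V s]
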